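/- Let δ > 0. For every v, x ∈ ℝ^d and every ξ ∈ Θ, one has |E_u[((f(x + δu, ξ) − f(x, ξ))/δ) · uᵀv] − ⟨∇f(x,ξ), v⟩| ≤ (L δ d^{3/2} / 2) ‖v‖. -/

import Mathlib

open scoped BigOperators RealInnerProductSpace

/-- The random sign vector `u ∈ {−1,1}^d` encoded by a boolean vector. -/
noncomputable def signVec (d : ℕ) (u : Fin d → Bool) : EuclideanSpace ℝ (Fin d) :=
  (WithLp.equiv 2 (Fin d → ℝ)).symm (fun i => if u i then (1 : ℝ) else -1)

open Finset

lemma signVec_apply (d : ℕ) (u : Fin d → Bool) (i : Fin d) :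
    signVec d u i = if u i then 1 else -1 := rfl

lemma norm_signVec (d : ℕ) (u : Fin d → Bool) : ‖signVec d u‖ = √d := by
  rw [EuclideanSpace.norm_eq]
  have h : ∀ i, ‖signVec d u i‖ ^ 2 = 1 := fun i => by
    rw [signVec_apply]; split <;> simp
  simp only [h, sum_const, card_univ, Fintype.card_fin, nsmul_eq_mul, mul_one]

lemma sum_signVec_mul_signVec (d : ℕ) (i j : Fin d) :
    ∑ u : Fin d → Bool, signVec d u i * signVec d u j = if i = j then (2 : ℝ) ^ d else 0 := by
  split_ifs with hij
  · subst hij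
    have h : ∀ u, signVec d u i * signVec d u i = 1 := fun u => by
      rw [signVec_apply]; split <;> simp
    simp [h]
  · refine sum_involution (fun u _ => Function.update u i (!u i)) ?_ ?_ ?_ ?_
    · intro u _
      simp only [signVec_apply, Function.update_self, Function.update_of_ne (Ne.symm hij)]
      cases u i <;> cases u j <;> simp
    · intro u _ _ h
      simpa using congrFun h i
    · simp
    · simp

lemma sum_inner_signVec_mul_inner_signVec (d : ℕ) (a b : EuclideanSpace ℝ (Fin d)) :
    ∑ u : Fin d → Bool, ⟪a, signVec d u⟫ * ⟪signVec d u, b⟫ = 2 ^ d * ⟪a, b⟫ := by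
  have h : ∀ u : Fin d → Bool, ⟪a, signVec d u⟫ * ⟪signVec d u, b⟫
      = ∑ i, ∑ j, a i * b j * (signVec d u i * signVec d u j) := fun u => by
    simp only [PiLp.inner_apply, RCLike.inner_apply, conj_trivial]
    rw [sum_mul_sum]
    exact sum_congr rfl fun i _ => sum_congr rfl fun j _ => by ring
  simp_rw [h]
  rw [sum_comm]
  simp_rw [sum_comm (s := (univ : Finset (Fin d → Bool))), ← mul_sum, sum_signVec_mul_signVec]
  simp only [mul_ite, mul_zero, sum_ite_eq, mem_univ, if_true, PiLp.inner_apply,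
    RCLike.inner_apply, conj_trivial, mul_sum]
  exact sum_congr rfl fun i _ => by ring

/-- Quadratic upper bound on the first-order Taylor remainder of a function whose gradient is
Lipschitz. -/
lemma abs_sub_sub_inner_le_of_lipschitz_gradient {E : Type*} [NormedAddCommGroup E]
    [InnerProductSpace ℝ E] [CompleteSpace E] {g : E → ℝ} {g' : E → E} {L : ℝ}
    (hg : ∀ x, HasGradientAt g (g' x) x) (hL : ∀ x y, ‖g' x - g' y‖ ≤ L * ‖x - y‖) (x w : E) :
    |g (x + w) - g x - ⟪g' x, w⟫| ≤ L / 2 * ‖w‖ ^ 2 := by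
  have hφ : ∀ t : ℝ, HasDerivAt (fun t : ℝ => g (x + t • w) - g x - t * ⟪g' x, w⟫)
      (⟪g' (x + t • w) - g' x, w⟫) t := fun t => by
    have hline : HasDerivAt (fun t : ℝ => x + t • w) w t := by
      simpa using ((hasDerivAt_id t).smul_const w).const_add x
    have hcomp := (hg (x + t • w)).hasFDerivAt.comp_hasDerivAt t hline
    rw [InnerProductSpace.toDual_apply_apply] at hcomp
    rw [inner_sub_left]
    simpa only [one_mul] using!
      (hcomp.sub_const (g x)).sub ((hasDerivAt_id t).mul_const ⟪g' x, w⟫)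
  have hB : ∀ t : ℝ, HasDerivAt (fun t : ℝ => L / 2 * ‖w‖ ^ 2 * t ^ 2) (L * ‖w‖ ^ 2 * t) t :=
    fun t => ((hasDerivAt_pow 2 t).const_mul (L / 2 * ‖w‖ ^ 2)).congr_deriv (by push_cast; ring)
  have key := image_norm_le_of_norm_deriv_right_le_deriv_boundary (a := 0) (b := 1)
    (fun t _ => (hφ t).continuousAt.continuousWithinAt) (fun t _ => (hφ t).hasDerivWithinAt)
    (by simp) hB ?_ (Set.right_mem_Icc.2 zero_le_one)
  · simpa using key
  · intro t ht
    calc ‖⟪g' (x + t • w) - g' x, w⟫‖ ≤ ‖g' (x + t • w) - g' x‖ * ‖w‖ := norm_inner_le_norm _ _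
      _ ≤ L * ‖x + t • w - x‖ * ‖w‖ := by gcongr; exact hL _ _
      _ = L * ‖w‖ ^ 2 * t := by
        rw [add_sub_cancel_left, norm_smul, Real.norm_of_nonneg ht.1]; ring

/-- If `f(·,ξ)` is differentiable with `L`-Lipschitz gradient, then for all
`v, x ∈ ℝ^d` and `ξ ∈ Θ`,
`|E_u[((f(x+δu,ξ) − f(x,ξ))/δ) · uᵀv] − ⟨∇f(x,ξ), v⟩| ≤ (L δ d^{3/2}/2) ‖v‖`,
where `E_u` is the uniform average over the `2^d` sign vectors. -/
theorem stmt_1 {d : ℕ} {Θ : Type*}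
    (f : EuclideanSpace ℝ (Fin d) → Θ → ℝ)
    (f' : EuclideanSpace ℝ (Fin d) → Θ → EuclideanSpace ℝ (Fin d)) (L : ℝ)
    (hgrad : ∀ (ξ : Θ) (x : EuclideanSpace ℝ (Fin d)),
      HasGradientAt (fun y => f y ξ) (f' x ξ) x)
    (hlip : ∀ (ξ : Θ) (x₁ x₂ : EuclideanSpace ℝ (Fin d)),
      ‖f' x₁ ξ - f' x₂ ξ‖ ≤ L * ‖x₁ - x₂‖)
    (δ : ℝ) (hδ : 0 < δ) (v x : EuclideanSpace ℝ (Fin d)) (ξ : Θ) :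
    |(∑ u : Fin d → Bool,
        ((f (x + δ • signVec d u) ξ - f x ξ) / δ) * ⟪signVec d u, v⟫) / 2 ^ d
      - ⟪f' x ξ, v⟫|
      ≤ L * δ * (d : ℝ) ^ ((3 : ℝ) / 2) / 2 * ‖v‖ := by
  have hpow : (d : ℝ) ^ ((3 : ℝ) / 2) = d * √d := by
    rw [Real.sqrt_eq_rpow, show (3 : ℝ) / 2 = 1 + 1 / 2 by norm_num,
      Real.rpow_add_of_nonneg d.cast_nonneg zero_le_one (by norm_num), Real.rpow_one]
  have hrem : ∀ u : Fin d → Bool,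
      |(f (x + δ • signVec d u) ξ - f x ξ) / δ - ⟪f' x ξ, signVec d u⟫| ≤ L * δ * d / 2 := by
    intro u
    have h := abs_sub_sub_inner_le_of_lipschitz_gradient (hgrad ξ) (hlip ξ) x (δ • signVec d u)
    rw [inner_smul_right, norm_smul, norm_signVec, mul_pow, Real.sq_sqrt d.cast_nonneg,
      Real.norm_of_nonneg hδ.le] at h
    rw [show (f (x + δ • signVec d u) ξ - f x ξ) / δ - ⟪f' x ξ, signVec d u⟫
      = (f (x + δ • signVec d u) ξ - f x ξ - δ * ⟪f' x ξ, signVec d u⟫) / δ by field_simp,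
      abs_div, abs_of_pos hδ, div_le_iff₀ hδ]
    exact h.trans_eq (by ring)
  have hterm : ∀ u : Fin d → Bool,
      |((f (x + δ • signVec d u) ξ - f x ξ) / δ - ⟪f' x ξ, signVec d u⟫) * ⟪signVec d u, v⟫|
        ≤ L * δ * d / 2 * (√d * ‖v‖) := by
    intro u
    rw [abs_mul]
    refine mul_le_mul (hrem u) ?_ (abs_nonneg _) ((abs_nonneg _).trans (hrem u))
    simpa only [norm_signVec] using abs_real_inner_le_norm (signVec d u) v
  have hsum := (abs_sum_le_sum_abs _ univ).trans (sum_le_sum fun u _ => hterm u)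
  simp only [sub_mul, sum_sub_distrib, sum_inner_signVec_mul_inner_signVec, sum_const, card_univ,
    Fintype.card_fun, Fintype.card_bool, Fintype.card_fin, nsmul_eq_mul, Nat.cast_pow,
    Nat.cast_ofNat] at hsum
  have h2 : (0 : ℝ) < 2 ^ d := by positivity
  rw [div_sub' h2.ne', abs_div, abs_of_pos h2, div_le_iff₀ h2, hpow]
  exact hsum.trans_eq (by ring)
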